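/- arXiv:1406.4852 — 2 statements merged into one kernel-verified Lean document; each statement's English description precedes it below -/
import Mathlib

section
/- Let (M, (W_j), (S_i^j)) be an exact-repair regenerating code with parameters (n,k,d) and secondary parameters (B,α,β), where n ≥ d+1, let p be an integer with 2 ≤ p ≤ k−2, and suppose (d−p)β ≤ α ≤ (d−p+1)β. Then 3B ≤ 3B_p − β/2, i.e. B ≤ B_p − β/6. -/
open Finset

/-- Shannon entropy (base 2) of a finitely-valued random variable `X` on a finite
probability space with mass function `P`. -/
noncomputable def entH {Ω S : Type*} [Fintype Ω] (P : Ω → ℝ) (X : Ω → S) : ℝ :=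
  letI := Classical.decEq S
  ∑ s ∈ Finset.univ.image X,
    -((∑ ω ∈ Finset.univ.filter (fun ω => X ω = s), P ω) *
       Real.logb 2 (∑ ω ∈ Finset.univ.filter (fun ω => X ω = s), P ω))

/-- Conditional entropy `H(X | Y) = H(X, Y) - H(Y)`. -/
noncomputable def condH {Ω S T : Type*} [Fintype Ω] (P : Ω → ℝ) (X : Ω → S) (Y : Ω → T) : ℝ :=
  entH P (fun ω => (X ω, Y ω)) - entH P Y

/-- The joint random variable `W_J = (W_j : j ∈ J)`. -/
def jointW {Ω : Type*} {n : ℕ} {σW : Fin n → Type*} (W : ∀ j, Ω → σW j)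
    (J : Finset (Fin n)) : Ω → ∀ j : J, σW j.1 :=
  fun ω j => W j.1 ω

/-- The joint random variable `(S_i^j : (i,j) ∈ E)` for a set `E` of pairs. -/
def jointS {Ω : Type*} {n : ℕ} {σS : Fin n → Fin n → Type*} (S : ∀ i j, Ω → σS i j)
    (E : Finset (Fin n × Fin n)) : Ω → ∀ e : E, σS e.1.1 e.1.2 :=
  fun ω e => S e.1.1 e.1.2 ω

/-- The joint random variable `S_I^j = (S_i^j : i ∈ I)`. -/
def jointSto {Ω : Type*} {n : ℕ} {σS : Fin n → Fin n → Type*} (S : ∀ i j, Ω → σS i j)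
    (I : Finset (Fin n)) (j : Fin n) : Ω → ∀ i : I, σS i.1 j :=
  fun ω i => S i.1 j ω

/-- An exact-repair regenerating code with parameters `(n,k,d)` (with `1 ≤ k ≤ d ≤ n-1`)
and secondary parameters `(B,α,β)`: the file `M`, the stored data `W j` on server `j`
(servers indexed by `Fin n`, server `j` of the paper being index `j-1`), and the helper
information `S i j` sent from server `i` to repair server `j`. -/
structure IsRegenCode {Ω : Type*} [Fintype Ω] (n k d : ℕ) (B α β : ℝ) (P : Ω → ℝ)
    {σM : Type*} {σW : Fin n → Type*} {σS : Fin n → Fin n → Type*}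
    (M : Ω → σM) (W : ∀ j, Ω → σW j) (S : ∀ i j, Ω → σS i j) : Prop where
  prob_nonneg : ∀ ω, 0 ≤ P ω
  prob_sum : ∑ ω, P ω = 1
  hk : 1 ≤ k
  hkd : k ≤ d
  hdn : d + 1 ≤ n
  hB : 0 ≤ B
  hα : 0 ≤ α
  hβ : 0 ≤ β
  hMB : entH P M = B
  hWα : ∀ j, entH P (W j) = α
  hWM : ∀ j, condH P (W j) M = 0
  hMW : ∀ J : Finset (Fin n), k ≤ J.card → condH P M (jointW W J) = 0
  hSβ : ∀ i j, i ≠ j → entH P (S i j) = β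
  hSW : ∀ i j, i ≠ j → condH P (S i j) (W i) = 0
  hWS : ∀ (j : Fin n) (I : Finset (Fin n)), d ≤ I.card → j ∉ I →
    condH P (W j) (jointSto S I j) = 0

/-- `B_q = qα + ((k-q)(k-q-1)/2)β + (d+1-k)(k-q)β`. -/
noncomputable def Bfun (k d q : ℕ) (α β : ℝ) : ℝ :=
  (q : ℝ) * α + (((k - q) * (k - q - 1) : ℕ) : ℝ) / 2 * β
    + (((d + 1 - k) * (k - q) : ℕ) : ℝ) * β

section Entropy

variable {Ω : Type*} [Fintype Ω] {P : Ω → ℝ}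

open scoped Classical in
/-- The probability of the event that `X` takes the value `X ω`. -/
noncomputable def fiberMass {S : Type*} (P : Ω → ℝ) (X : Ω → S) (ω : Ω) : ℝ :=
  ∑ ω', if X ω' = X ω then P ω' else 0

/-- `X` is a function of `Y` on the support of `P`. -/
def Determines {S T : Type*} (P : Ω → ℝ) (Y : Ω → T) (X : Ω → S) : Prop :=
  ∀ ω ω', 0 < P ω → 0 < P ω' → Y ω = Y ω' → X ω = X ω'

lemma entH_eq_sum {S : Type*} (X : Ω → S) :
    entH P X = ∑ ω, -(P ω * Real.logb 2 (fiberMass P X ω)) := by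
  classical
  unfold entH
  rw [← Finset.sum_fiberwise_of_maps_to (s := univ) (t := Finset.univ.image X) (g := X)
    (fun ω _ => Finset.mem_image_of_mem X (Finset.mem_univ ω))]
  refine Finset.sum_congr (by congr) fun s _ => ?_
  have key : ∀ ω ∈ univ.filter (fun ω => X ω = s),
      -(P ω * Real.logb 2 (fiberMass P X ω)) =
        -(P ω * Real.logb 2 (∑ ω' ∈ univ.filter (fun ω => X ω = s), P ω')) := by
    intro ω hω
    rw [Finset.mem_filter] at hω
    rw [fiberMass, Finset.sum_filter, hω.2]
  rw [Finset.sum_congr rfl key, Finset.sum_neg_distrib, ← Finset.sum_mul]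

lemma fiberMass_nonneg (hP : ∀ ω, 0 ≤ P ω) {S : Type*} (X : Ω → S) (ω : Ω) :
    0 ≤ fiberMass P X ω := by
  classical
  exact Finset.sum_nonneg fun ω' _ => by split_ifs <;> simp [hP]

lemma le_fiberMass (hP : ∀ ω, 0 ≤ P ω) {S : Type*} (X : Ω → S) (ω : Ω) :
    P ω ≤ fiberMass P X ω := by
  classical
  have := Finset.single_le_sum (f := fun ω' => if X ω' = X ω then P ω' else 0)
    (fun ω' _ => by split_ifs <;> simp [hP]) (Finset.mem_univ ω)
  simpa [fiberMass] using this

lemma fiberMass_le_of_determines (hP : ∀ ω, 0 ≤ P ω) {S T : Type*} {X : Ω → S} {Y : Ω → T}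
    (h : Determines P Y X) {ω : Ω} (hω : 0 < P ω) : fiberMass P Y ω ≤ fiberMass P X ω := by
  classical
  refine Finset.sum_le_sum fun ω' _ => ?_
  rcases (hP ω').eq_or_lt with h0 | h0
  · simp [← h0]
  · by_cases hY : Y ω' = Y ω
    · simp [hY, h ω' ω h0 hω hY]
    · simp only [hY, if_false]
      split_ifs <;> simp [hP]

lemma entH_le_of_determines (hP : ∀ ω, 0 ≤ P ω) {S T : Type*} {X : Ω → S} {Y : Ω → T}
    (h : Determines P Y X) : entH P X ≤ entH P Y := by
  rw [entH_eq_sum, entH_eq_sum]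
  refine Finset.sum_le_sum fun ω _ => ?_
  rcases (hP ω).eq_or_lt with h0 | h0
  · simp [← h0]
  · refine neg_le_neg (mul_le_mul_of_nonneg_left ?_ h0.le)
    exact Real.logb_le_logb_of_le (by norm_num) (h0.trans_le (le_fiberMass hP Y ω))
      (fiberMass_le_of_determines hP h h0)

lemma fiberMass_le_one (hP : ∀ ω, 0 ≤ P ω) (hP1 : ∑ ω, P ω = 1) {S : Type*} (X : Ω → S) (ω : Ω) :
    fiberMass P X ω ≤ 1 := by
  classical
  rw [← hP1]
  exact Finset.sum_le_sum fun ω' _ => by split_ifs <;> simp [hP]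

lemma entH_nonneg (hP : ∀ ω, 0 ≤ P ω) (hP1 : ∑ ω, P ω = 1) {S : Type*} (X : Ω → S) :
    0 ≤ entH P X := by
  rw [entH_eq_sum]
  refine Finset.sum_nonneg fun ω _ => neg_nonneg.2 (mul_nonpos_of_nonneg_of_nonpos (hP ω) ?_)
  exact Real.logb_nonpos (by norm_num) (fiberMass_nonneg hP X ω) (fiberMass_le_one hP hP1 X ω)

lemma determines_of_condH_eq_zero (hP : ∀ ω, 0 ≤ P ω) {S T : Type*} {X : Ω → S} {Y : Ω → T}
    (h : condH P X Y = 0) : Determines P Y X := by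
  classical
  set Z : Ω → S × T := fun ω => (X ω, Y ω) with hZ
  have hZY : Determines P Z Y := fun ω ω' _ _ h => (Prod.ext_iff.1 h).2
  have h' : ∑ ω, (-(P ω * Real.logb 2 (fiberMass P Z ω)) -
      -(P ω * Real.logb 2 (fiberMass P Y ω))) = 0 := by
    rw [Finset.sum_sub_distrib, ← entH_eq_sum, ← entH_eq_sum]
    exact h
  rw [Finset.sum_eq_zero_iff_of_nonneg] at h'
  · intro ω ω' hω hω' hY
    have h1 := h' ω (Finset.mem_univ _)
    have hpos : 0 < fiberMass P Z ω := hω.trans_le (le_fiberMass hP Z ω)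
    have hlog : Real.logb 2 (fiberMass P Z ω) = Real.logb 2 (fiberMass P Y ω) := by
      have : P ω * (Real.logb 2 (fiberMass P Y ω) - Real.logb 2 (fiberMass P Z ω)) = 0 := by
        linarith
      rcases mul_eq_zero.1 this with h2 | h2
      · exact absurd h2 hω.ne'
      · linarith
    have heq : fiberMass P Z ω = fiberMass P Y ω :=
      Real.logb_injOn_pos (by norm_num) hpos
        (hω.trans_le (le_fiberMass hP Y ω)) hlog
    by_contra hX
    refine heq.not_lt (Finset.sum_lt_sum (fun ω'' _ => ?_) ⟨ω', Finset.mem_univ _, ?_⟩)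
    · by_cases hc : Z ω'' = Z ω
      · simp [hc, show Y ω'' = Y ω from (Prod.ext_iff.1 hc).2]
      · simp only [hc, if_false]
        split_ifs <;> simp [hP]
    · have hc : Z ω' ≠ Z ω := fun hc => hX (Prod.ext_iff.1 hc).1.symm
      simpa [hc, hY] using hω'
  · intro ω _
    rcases (hP ω).eq_or_lt with h0 | h0
    · simp [← h0]
    · have := mul_le_mul_of_nonneg_left (Real.logb_le_logb_of_le (b := 2) (by norm_num)
        (h0.trans_le (le_fiberMass hP Z ω)) (fiberMass_le_of_determines hP hZY h0)) h0.le
      linarith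

lemma fiberMass_congr {S : Type*} {X : Ω → S} {ω ω' : Ω} (h : X ω = X ω') :
    fiberMass P X ω = fiberMass P X ω' := by
  unfold fiberMass
  rw [h]

open scoped Classical in
lemma sum_fiber_div_le_one {S : Type*} (X : Ω → S) (s : S) :
    ∑ ω, (if X ω = s then P ω / fiberMass P X ω else 0) ≤ 1 := by
  by_cases hs : ∃ ω, X ω = s
  · obtain ⟨ω₀, rfl⟩ := hs
    have : ∀ ω, (if X ω = X ω₀ then P ω / fiberMass P X ω else 0) =
        (if X ω = X ω₀ then P ω else 0) / fiberMass P X ω₀ := by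
      intro ω
      split_ifs with h
      · rw [fiberMass_congr h]
      · simp
    rw [Finset.sum_congr rfl fun ω _ => this ω, ← Finset.sum_div]
    exact div_self_le_one _
  · push Not at hs
    simp [hs]

lemma sum_mul_div_le_one (hP : ∀ ω, 0 ≤ P ω) (hP1 : ∑ ω, P ω = 1)
    {S T U : Type*} {A : Ω → S} {C : Ω → T} {I : Ω → U}
    (hA : Determines P A I) (hC : Determines P C I) :
    ∑ ω, P ω * (fiberMass P A ω * fiberMass P C ω /
      (fiberMass P (fun ω => (A ω, C ω)) ω * fiberMass P I ω)) ≤ 1 := by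
  classical
  set Z : Ω → S × T := fun ω => (A ω, C ω) with hZ
  have expand : ∀ ω, P ω * (fiberMass P A ω * fiberMass P C ω /
      (fiberMass P Z ω * fiberMass P I ω)) =
      ∑ ω₁, ∑ ω₂, (if A ω₁ = A ω then P ω₁ else 0) * (if C ω₂ = C ω then P ω₂ else 0) *
        (P ω / (fiberMass P Z ω * fiberMass P I ω)) := by
    intro ω
    simp only [← Finset.sum_mul, ← Finset.mul_sum, fiberMass]
    ring
  have bound : ∀ ω₁ ω₂,
      ∑ ω, (if A ω₁ = A ω then P ω₁ else 0) * (if C ω₂ = C ω then P ω₂ else 0) *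
        (P ω / (fiberMass P Z ω * fiberMass P I ω)) ≤
      P ω₁ / fiberMass P I ω₁ * (if I ω₂ = I ω₁ then P ω₂ else 0) := by
    intro ω₁ ω₂
    have hc : 0 ≤ P ω₁ / fiberMass P I ω₁ * (if I ω₂ = I ω₁ then P ω₂ else 0) :=
      mul_nonneg (div_nonneg (hP _) (fiberMass_nonneg hP _ _)) (by split_ifs <;> simp [hP])
    refine le_trans ?_
      (mul_le_of_le_one_right hc (sum_fiber_div_le_one (P := P) Z (A ω₁, C ω₂)))
    rw [Finset.mul_sum]
    refine Finset.sum_le_sum fun ω _ => ?_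
    have hr : 0 ≤ P ω₁ / fiberMass P I ω₁ * (if I ω₂ = I ω₁ then P ω₂ else 0) *
        (if Z ω = (A ω₁, C ω₂) then P ω / fiberMass P Z ω else 0) :=
      mul_nonneg hc (by
        split_ifs
        · exact div_nonneg (hP _) (fiberMass_nonneg hP _ _)
        · exact le_rfl)
    rcases (hP ω₁).eq_or_lt with h1 | h1
    · simp [← h1]
    rcases (hP ω₂).eq_or_lt with h2 | h2
    · simp [← h2]
    rcases (hP ω).eq_or_lt with h0 | h0
    · simp [← h0]
    by_cases hA' : A ω₁ = A ω
    · by_cases hC' : C ω₂ = C ω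
      · have i1 := hA ω₁ ω h1 h0 hA'
        have i2 := hC ω₂ ω h2 h0 hC'
        have e1 : Z ω = (A ω₁, C ω₂) := by simp [hZ, hA', hC']
        rw [fiberMass_congr i1, if_pos hA', if_pos hC', if_pos e1, if_pos (i2.trans i1.symm)]
        apply le_of_eq
        ring
      · simpa [hC'] using hr
    · simpa [hA'] using hr
  rw [Finset.sum_congr rfl fun ω _ => expand ω, Finset.sum_comm,
    Finset.sum_congr rfl fun ω₁ _ => Finset.sum_comm, ← hP1]
  refine Finset.sum_le_sum fun ω₁ _ =>
    (Finset.sum_le_sum fun ω₂ _ => bound ω₁ ω₂).trans ?_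
  rw [← Finset.mul_sum]
  change P ω₁ / fiberMass P I ω₁ * fiberMass P I ω₁ ≤ P ω₁
  rcases eq_or_ne (fiberMass P I ω₁) 0 with h0 | h0
  · simp [h0, hP]
  · rw [div_mul_cancel₀ _ h0]

/-- Submodularity of entropy. -/
lemma entH_submodular (hP : ∀ ω, 0 ≤ P ω) (hP1 : ∑ ω, P ω = 1)
    {S T U V : Type*} {A : Ω → S} {C : Ω → T} {I : Ω → U} {X : Ω → V}
    (hA : Determines P A I) (hC : Determines P C I)
    (hX : Determines P (fun ω => (A ω, C ω)) X) :
    entH P X + entH P I ≤ entH P A + entH P C := by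
  refine (add_le_add_left (entH_le_of_determines hP hX) _).trans ?_
  have key := sum_mul_div_le_one hP hP1 hA hC
  set Z : Ω → S × T := fun ω => (A ω, C ω) with hZ
  have hlog2 : 0 < Real.log 2 := Real.log_pos (by norm_num)
  have hterm : ∀ ω, P ω * (Real.log (fiberMass P A ω) + Real.log (fiberMass P C ω)
      - Real.log (fiberMass P Z ω) - Real.log (fiberMass P I ω)) ≤
      P ω * (fiberMass P A ω * fiberMass P C ω / (fiberMass P Z ω * fiberMass P I ω)) - P ω := by
    intro ω
    rcases (hP ω).eq_or_lt with h0 | h0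
    · simp [← h0]
    · have pA := h0.trans_le (le_fiberMass hP A ω)
      have pC := h0.trans_le (le_fiberMass hP C ω)
      have pZ := h0.trans_le (le_fiberMass hP Z ω)
      have pI := h0.trans_le (le_fiberMass hP I ω)
      have := Real.log_le_sub_one_of_pos (div_pos (mul_pos pA pC) (mul_pos pZ pI))
      rw [Real.log_div (mul_pos pA pC).ne' (mul_pos pZ pI).ne', Real.log_mul pA.ne' pC.ne',
        Real.log_mul pZ.ne' pI.ne'] at this
      nlinarith
  have hsum := Finset.sum_le_sum fun ω (_ : ω ∈ univ) => hterm ω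
  rw [Finset.sum_sub_distrib, hP1] at hsum
  have hneg : ∑ ω, P ω * (Real.log (fiberMass P A ω) + Real.log (fiberMass P C ω)
      - Real.log (fiberMass P Z ω) - Real.log (fiberMass P I ω)) ≤ 0 := by linarith
  have hrepr : entH P Z + entH P I - (entH P A + entH P C) =
      (∑ ω, P ω * (Real.log (fiberMass P A ω) + Real.log (fiberMass P C ω)
      - Real.log (fiberMass P Z ω) - Real.log (fiberMass P I ω))) / Real.log 2 := by
    simp only [entH_eq_sum, ← Finset.sum_add_distrib, ← Finset.sum_sub_distrib, Finset.sum_div]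
    refine Finset.sum_congr rfl fun ω _ => ?_
    simp only [Real.logb]
    ring
  have := div_nonpos_of_nonpos_of_nonneg hneg hlog2.le
  linarith

end Entropy

section RegeneratingCode

variable {Ω : Type*} {n : ℕ}
  {σW : Fin n → Type*} {σS : Fin n → Fin n → Type*}
  {W : ∀ j, Ω → σW j} {S : ∀ i j, Ω → σS i j}

/-- The outcomes `ω` and `ω'` give the same values of `W j` for `j ∈ J` and of `S i j` for
`(i, j) ∈ E`. -/
def Agree (W : ∀ j, Ω → σW j) (S : ∀ i j, Ω → σS i j) (J : Finset (Fin n))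
    (E : Finset (Fin n × Fin n)) (ω ω' : Ω) : Prop :=
  (∀ j ∈ J, W j ω = W j ω') ∧ ∀ e ∈ E, S e.1 e.2 ω = S e.1 e.2 ω'

lemma joint_eq_iff_agree {J : Finset (Fin n)} {E : Finset (Fin n × Fin n)} {ω ω' : Ω} :
    (jointW W J ω, jointS S E ω) = (jointW W J ω', jointS S E ω') ↔ Agree W S J E ω ω' := by
  simp only [Prod.mk.injEq, funext_iff, Agree, jointW, jointS, Subtype.forall]

variable [Fintype Ω] {P : Ω → ℝ}

/-- The joint entropy of the `W j` for `j ∈ J` and the `S i j` for `(i, j) ∈ E`. -/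
noncomputable def networkH (P : Ω → ℝ) (W : ∀ j, Ω → σW j) (S : ∀ i j, Ω → σS i j)
    (J : Finset (Fin n)) (E : Finset (Fin n × Fin n)) : ℝ :=
  entH P (fun ω => (jointW W J ω, jointS S E ω))

lemma networkH_submodular (hP : ∀ ω, 0 ≤ P ω) (hP1 : ∑ ω, P ω = 1)
    {J₁ J₂ J₃ J₄ : Finset (Fin n)} {E₁ E₂ E₃ E₄ : Finset (Fin n × Fin n)}
    (h₁ : ∀ ω ω', 0 < P ω → 0 < P ω' → Agree W S J₁ E₁ ω ω' → Agree W S J₄ E₄ ω ω')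
    (h₂ : ∀ ω ω', 0 < P ω → 0 < P ω' → Agree W S J₂ E₂ ω ω' → Agree W S J₄ E₄ ω ω')
    (h : ∀ ω ω', 0 < P ω → 0 < P ω' → Agree W S J₁ E₁ ω ω' → Agree W S J₂ E₂ ω ω' →
      Agree W S J₃ E₃ ω ω') :
    networkH P W S J₃ E₃ + networkH P W S J₄ E₄ ≤
      networkH P W S J₁ E₁ + networkH P W S J₂ E₂ :=
  entH_submodular hP hP1
    (fun ω ω' hω hω' heq => joint_eq_iff_agree.2 (h₁ ω ω' hω hω' (joint_eq_iff_agree.1 heq)))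
    (fun ω ω' hω hω' heq => joint_eq_iff_agree.2 (h₂ ω ω' hω hω' (joint_eq_iff_agree.1 heq)))
    (fun ω ω' hω hω' heq => joint_eq_iff_agree.2 (h ω ω' hω hω'
      (joint_eq_iff_agree.1 (Prod.ext_iff.1 heq).1) (joint_eq_iff_agree.1 (Prod.ext_iff.1 heq).2)))

lemma networkH_le_add (hP : ∀ ω, 0 ≤ P ω) (hP1 : ∑ ω, P ω = 1)
    {J₁ J₂ J₃ : Finset (Fin n)} {E₁ E₂ E₃ : Finset (Fin n × Fin n)}
    (h : ∀ ω ω', 0 < P ω → 0 < P ω' → Agree W S J₁ E₁ ω ω' → Agree W S J₂ E₂ ω ω' →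
      Agree W S J₃ E₃ ω ω') :
    networkH P W S J₃ E₃ ≤ networkH P W S J₁ E₁ + networkH P W S J₂ E₂ := by
  have h0 : ∀ ω ω', Agree W S ∅ ∅ ω ω' := fun ω ω' => by simp [Agree]
  have := networkH_submodular hP hP1 (fun ω ω' _ _ _ => h0 ω ω') (fun ω ω' _ _ _ => h0 ω ω') h
  have h1 : 0 ≤ networkH P W S ∅ ∅ := entH_nonneg hP hP1 _
  linarith

lemma networkH_empty (hP : ∀ ω, 0 ≤ P ω) (hP1 : ∑ ω, P ω = 1) : networkH P W S ∅ ∅ = 0 := by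
  refine le_antisymm ?_ (entH_nonneg hP hP1 _)
  have h : networkH P W S ∅ ∅ + networkH P W S ∅ ∅ ≤ entH P (fun _ : Ω => ()) +
      entH P (fun _ : Ω => ()) :=
    entH_submodular hP hP1 (fun ω ω' _ _ _ => joint_eq_iff_agree.2 (by simp [Agree]))
      (fun ω ω' _ _ _ => joint_eq_iff_agree.2 (by simp [Agree]))
      (fun ω ω' _ _ _ => joint_eq_iff_agree.2 (by simp [Agree]))
  have : entH P (fun _ : Ω => ()) = 0 := by
    classical
    simp [entH_eq_sum, fiberMass, hP1]
  linarith

variable {k d : ℕ} {B α β : ℝ} {σM : Type*} {M : Ω → σM}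

namespace IsRegenCode

lemma networkH_le_card (hc : IsRegenCode n k d B α β P M W S) (J : Finset (Fin n))
    (E : Finset (Fin n × Fin n)) (hE : ∀ e ∈ E, e.1 ≠ e.2) :
    networkH P W S J E ≤ J.card * α + E.card * β := by
  have hP := hc.prob_nonneg
  have hP1 := hc.prob_sum
  induction J using Finset.induction_on with
  | empty =>
    induction E using Finset.induction_on with
    | empty => simp [networkH_empty hP hP1]
    | insert e E he ih =>
      have h1 := ih fun e he => hE e (Finset.mem_insert_of_mem he)
      have h2 : networkH P W S ∅ {e} ≤ β := by
        rw [← hc.hSβ e.1 e.2 (hE e (Finset.mem_insert_self _ _))]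
        exact entH_le_of_determines hP fun ω ω' _ _ h =>
          joint_eq_iff_agree.2 (by simpa [Agree] using h)
      have h3 := networkH_le_add (W := W) (S := S) hP hP1 (J₁ := ∅) (J₂ := ∅) (J₃ := ∅)
        (E₁ := E) (E₂ := {e}) (E₃ := insert e E) fun ω ω' _ _ h h' => by
          simp only [Agree, Finset.mem_insert, Finset.mem_singleton, forall_eq_or_imp] at *
          exact ⟨h.1, h'.2 e rfl, h.2⟩
      rw [Finset.card_insert_of_notMem he]
      push_cast
      linarith
  | insert j J hj ih =>
    have h2 : networkH P W S {j} ∅ ≤ α := by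
      rw [← hc.hWα j]
      exact entH_le_of_determines hP fun ω ω' _ _ h =>
        joint_eq_iff_agree.2 (by simpa [Agree] using h)
    have h3 := networkH_le_add (W := W) (S := S) hP hP1 (J₁ := J) (J₂ := {j}) (J₃ := insert j J)
      (E₁ := E) (E₂ := ∅) (E₃ := E) fun ω ω' _ _ h h' => by
        simp only [Agree, Finset.mem_insert, Finset.mem_singleton, forall_eq_or_imp] at *
        exact ⟨⟨h'.1 j rfl, h.1⟩, h.2⟩
    rw [Finset.card_insert_of_notMem hj]
    push_cast
    linarith

lemma helper_eq (hc : IsRegenCode n k d B α β P M W S) {ω ω' : Ω} (hω : 0 < P ω) (hω' : 0 < P ω')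
    {i j : Fin n} (hij : i ≠ j) (h : W i ω = W i ω') : S i j ω = S i j ω' :=
  determines_of_condH_eq_zero hc.prob_nonneg (hc.hSW i j hij) ω ω' hω hω' h

lemma repair_eq (hc : IsRegenCode n k d B α β P M W S) {ω ω' : Ω} (hω : 0 < P ω) (hω' : 0 < P ω')
    {V : Finset (Fin n)} {v : Fin n} (hV : V.card = d + 1) (hv : v ∈ V)
    (h : ∀ i ∈ V, i ≠ v → S i v ω = S i v ω') : W v ω = W v ω' := by
  refine determines_of_condH_eq_zero hc.prob_nonneg (hc.hWS v (V.erase v) ?_ (by simp)) ω ω' hω hω'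
    (funext fun i => h i.1 (Finset.mem_of_mem_erase i.2) (Finset.ne_of_mem_erase i.2))
  rw [Finset.card_erase_of_mem hv]
  omega

/-- Completing the storage of `k - m` nodes to the file by repairing `m` further nodes. -/
lemma fileSize_le (hc : IsRegenCode n k d B α β P M W S) (m : ℕ) (J : Finset (Fin n))
    (hJ : J.card + m = k) :
    B ≤ networkH P W S J ∅ + (m * (m - 1) / 2 + (d + 1 - k) * m) * β := by
  have hP := hc.prob_nonneg
  have hP1 := hc.prob_sum
  induction m generalizing J with
  | zero =>
    have h : B ≤ networkH P W S J ∅ := by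
      rw [← hc.hMB]
      refine entH_le_of_determines hP fun ω ω' hω hω' h => ?_
      exact determines_of_condH_eq_zero hP (hc.hMW J (by omega)) ω ω' hω hω' (Prod.ext_iff.1 h).1
    simpa using h
  | succ m ih =>
    have hkd := hc.hkd
    have hdn := hc.hdn
    obtain ⟨v, hv⟩ : ∃ v, v ∉ J := by
      by_contra! h
      have := Finset.card_le_card (fun v _ => h v : (univ : Finset (Fin n)) ⊆ J)
      rw [Finset.card_univ, Fintype.card_fin] at this
      omega
    obtain ⟨V, hJV, -, hV⟩ := Finset.exists_subsuperset_card_eq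
      (Finset.subset_univ (insert v J)) (n := d + 1)
      (by rw [Finset.card_insert_of_notMem hv]; omega)
      (by rw [Finset.card_univ, Fintype.card_fin]; omega)
    have hvV : v ∈ V := hJV (Finset.mem_insert_self _ _)
    set E : Finset (Fin n × Fin n) := (V \ insert v J) ×ˢ {v} with hE
    have hEcard : (E.card : ℝ) = d - J.card := by
      rw [hE, Finset.card_product, Finset.card_sdiff_of_subset hJV, hV,
        Finset.card_insert_of_notMem hv, Finset.card_singleton, mul_one,
        Nat.cast_sub (by omega)]
      push_cast
      ring
    have h1 := ih (insert v J) (by rw [Finset.card_insert_of_notMem hv]; omega)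
    have h2 : networkH P W S ∅ E ≤ E.card * β := by
      have := hc.networkH_le_card ∅ E (by
        rintro ⟨i, j⟩ he
        simp only [hE, Finset.mem_product, Finset.mem_sdiff, Finset.mem_insert,
          Finset.mem_singleton, not_or] at he
        rw [he.2]
        exact he.1.2.1)
      simpa using this
    have h3 := networkH_le_add (W := W) (S := S) hP hP1 (J₁ := J) (J₂ := ∅) (J₃ := insert v J)
      (E₁ := ∅) (E₂ := E) (E₃ := ∅) fun ω ω' hω hω' h h' => by
        refine ⟨fun j hj => ?_, by simp⟩
        rcases Finset.mem_insert.1 hj with rfl | hj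
        · refine hc.repair_eq hω hω' hV hvV fun i hi hij => ?_
          by_cases hiJ : i ∈ J
          · exact hc.helper_eq hω hω' hij (h.1 i hiJ)
          · exact h'.2 (i, j) (by simp [hE, hi, hij, hiJ])
        · exact h.1 j hj
    rw [hEcard] at h2
    have hk : (k : ℝ) = J.card + m + 1 := by rw [← hJ]; push_cast; ring
    rw [hk] at h1 ⊢
    push_cast
    nlinarith

set_option maxHeartbeats 1000000 in
/-- Three copies of the file extracted from helper messages sent to the two nodes `a₂` and `a₃`. -/
lemma three_mul_fileSize_le (hc : IsRegenCode n k d B α β P M W S)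
    {a₁ a₂ a₃ a₄ : Fin n} {F Y X : Finset (Fin n)}
    (h₁₂ : a₁ ≠ a₂) (h₁₃ : a₁ ≠ a₃) (h₁₄ : a₁ ≠ a₄) (h₂₃ : a₂ ≠ a₃) (h₂₄ : a₂ ≠ a₄) (h₃₄ : a₃ ≠ a₄)
    (hF : Disjoint {a₁, a₂, a₃, a₄} F) (hY : Disjoint ({a₁, a₂, a₃, a₄} ∪ F) Y)
    (hX : Disjoint ({a₁, a₂, a₃, a₄} ∪ F ∪ Y) X)
    (hcard : 4 + F.card + Y.card + X.card = d + 1) (hF1 : F.card ≤ 1)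
    (m : ℕ) (hm : Y.card + F.card + 3 + m = k) :
    3 * B ≤ (3 * Y.card + F.card + 4) * α
      + (2 * (2 + F.card + X.card) + (1 + 2 * X.card) + (1 + X.card) * F.card) * β
      + ((m + 1 + F.card) * (m + F.card) / 2 + (d + 1 - k) * (m + 1 + F.card)) * β
      + 2 * ((m * (m - 1) / 2 + (d + 1 - k) * m) * β) := by
  have hP := hc.prob_nonneg
  have hP1 := hc.prob_sum
  set V : Finset (Fin n) := {a₁, a₂, a₃, a₄} ∪ F ∪ Y ∪ X with hVdef
  have hVcard : V.card = d + 1 := by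
    rw [hVdef, Finset.card_union_of_disjoint hX, Finset.card_union_of_disjoint hY,
      Finset.card_union_of_disjoint hF, ← hcard]
    simp [h₁₂, h₁₃, h₁₄, h₂₃, h₂₄, h₃₄]
  have hVmem : ∀ i, i ∈ V ↔ i = a₁ ∨ i = a₂ ∨ i = a₃ ∨ i = a₄ ∨ i ∈ F ∨ i ∈ Y ∨ i ∈ X := by
    intro i
    simp only [hVdef, Finset.mem_union, Finset.mem_insert, Finset.mem_singleton]
    tauto
  simp only [Finset.disjoint_union_left, Finset.disjoint_insert_left,
    Finset.disjoint_singleton_left] at hF hY hX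
  obtain ⟨hF₁, hF₂, hF₃, hF₄⟩ := hF
  obtain ⟨⟨hY₁, hY₂, hY₃, hY₄⟩, hYF⟩ := hY
  obtain ⟨⟨⟨hX₁, hX₂, hX₃, hX₄⟩, hXF⟩, hXY⟩ := hX
  have hne : ∀ {A : Finset (Fin n)} {a i : Fin n}, a ∉ A → i ∈ A → i ≠ a :=
    fun ha hi h => ha (h ▸ hi)
  set R : Finset (Fin n) := {a₁, a₄} ∪ (F ∪ X) with hR
  have hRcard : R.card = 2 + F.card + X.card := by
    rw [hR, Finset.card_union_of_disjoint, Finset.card_union_of_disjoint hXF,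
      Finset.card_pair h₁₄, add_assoc]
    simp [hF₁, hF₄, hX₁, hX₄]
  have hR₂ : a₂ ∉ R := by simp [hR, h₁₂.symm, h₂₄, hF₂, hX₂]
  have hR₃ : a₃ ∉ R := by simp [hR, h₁₃.symm, h₃₄, hF₃, hX₃]
  have hVR : ∀ i ∈ V, i = a₂ ∨ i = a₃ ∨ i ∈ Y ∨ i ∈ R := by
    intro i hi
    rw [hVmem] at hi
    simp only [hR, Finset.mem_union, Finset.mem_insert, Finset.mem_singleton]
    tauto
  have ha₁V : a₁ ∈ V := (hVmem _).2 (by simp)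
  have ha₂V : a₂ ∈ V := (hVmem _).2 (by simp)
  have ha₃V : a₃ ∈ V := (hVmem _).2 (by simp)
  have hYpair : Disjoint Y {a₂, a₃} := by simp [hY₂, hY₃]
  -- Repairing `b` from `Y`, `c` and the messages sent by `R`.
  have star : ∀ b c : Fin n, b ∈ V → b ≠ c → b ∉ Y → c ∉ Y → b ∉ R → c ∉ R →
      (∀ i ∈ V, i = b ∨ i = c ∨ i ∈ Y ∨ i ∈ R) →
      networkH P W S (insert c Y) (R ×ˢ {b}) ≤ (Y.card + 1) * α + (2 + F.card + X.card) * β ∧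
      ∀ ω ω', 0 < P ω → 0 < P ω' → Agree W S (insert c Y) (R ×ˢ {b}) ω ω' → W b ω = W b ω' := by
    intro b c hbV hbc hbY hcY hbR hcR hcov
    constructor
    · have := hc.networkH_le_card (insert c Y) (R ×ˢ {b}) (by
        rintro ⟨i, j⟩ he
        simp only [Finset.mem_product, Finset.mem_singleton] at he
        rw [he.2]
        exact hne hbR he.1)
      rw [Finset.card_insert_of_notMem hcY, Finset.card_product, hRcard,
        Finset.card_singleton] at this
      push_cast at this
      linarith
    · intro ω ω' hω hω' h
      refine hc.repair_eq hω hω' hVcard hbV fun i hi hib => ?_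
      rcases hcov i hi with rfl | rfl | hiY | hiR
      · exact absurd rfl hib
      · exact hc.helper_eq hω hω' hib (h.1 _ (by simp))
      · exact hc.helper_eq hω hω' hib (h.1 _ (by simp [hiY]))
      · exact h.2 (i, b) (by simp [hiR])
  obtain ⟨hZ₂, hrep₂⟩ := star a₂ a₃ ha₂V h₂₃ hY₂ hY₃ hR₂ hR₃ hVR
  obtain ⟨hZ₃, hrep₃⟩ := star a₃ a₂ ha₃V h₂₃.symm hY₃ hY₂ hR₃ hR₂ fun i hi => by
    have := hVR i hi
    tauto
  have hall₂ : ∀ ω ω', 0 < P ω → 0 < P ω' → Agree W S (insert a₃ Y) (R ×ˢ {a₂}) ω ω' →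
      Agree W S (Y ∪ {a₂, a₃}) ∅ ω ω' := by
    intro ω ω' hω hω' h
    refine ⟨fun j hj => ?_, by simp⟩
    simp only [Finset.mem_union, Finset.mem_insert, Finset.mem_singleton] at hj
    rcases hj with hj | rfl | rfl
    · exact h.1 _ (by simp [hj])
    · exact hrep₂ ω ω' hω hω' h
    · exact h.1 _ (by simp)
  have hall₃ : ∀ ω ω', 0 < P ω → 0 < P ω' → Agree W S (insert a₂ Y) (R ×ˢ {a₃}) ω ω' →
      Agree W S (Y ∪ {a₂, a₃}) ∅ ω ω' := by
    intro ω ω' hω hω' h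
    refine ⟨fun j hj => ?_, by simp⟩
    simp only [Finset.mem_union, Finset.mem_insert, Finset.mem_singleton] at hj
    rcases hj with hj | rfl | rfl
    · exact h.1 _ (by simp [hj])
    · exact h.1 _ (by simp)
    · exact hrep₃ ω ω' hω hω' h
  have hsub₁ := networkH_submodular hP hP1 (J₃ := Y ∪ {a₂, a₃}) (E₃ := R ×ˢ {a₂, a₃})
    hall₂ hall₃ (by
      intro ω ω' hω hω' h h'
      refine ⟨(hall₂ ω ω' hω hω' h).1, ?_⟩
      rintro ⟨i, j⟩ he
      simp only [Finset.mem_product, Finset.mem_insert, Finset.mem_singleton] at he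
      obtain ⟨hi, rfl | rfl⟩ := he
      · exact h.2 (i, j) (by simp [hi])
      · exact h'.2 (i, j) (by simp [hi]))
  have hB₁ := hc.fileSize_le (m + 1 + F.card) (Y ∪ {a₂, a₃}) (by
    rw [Finset.card_union_of_disjoint hYpair, Finset.card_pair h₂₃]
    omega)
  -- The messages exchanged by `a₁`, `F`, `X` with `a₂` and `a₃`.
  have hQ : networkH P W S (insert a₁ (Y ∪ F)) (insert (a₂, a₃) (X ×ˢ {a₂, a₃})) ≤
      (Y.card + F.card + 1) * α + (1 + 2 * X.card) * β := by
    have := hc.networkH_le_card (insert a₁ (Y ∪ F)) (insert (a₂, a₃) (X ×ˢ {a₂, a₃})) (by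
      rintro ⟨i, j⟩ he
      simp only [Finset.mem_product, Finset.mem_insert, Finset.mem_singleton,
        Prod.mk.injEq] at he
      rcases he with ⟨rfl, rfl⟩ | ⟨hi, rfl | rfl⟩
      · exact h₂₃
      · exact hne hX₂ hi
      · exact hne hX₃ hi)
    rw [Finset.card_insert_of_notMem (by simp [hY₁, hF₁]),
      Finset.card_union_of_disjoint hYF.symm, Finset.card_insert_of_notMem (by simp [hX₂]),
      Finset.card_product, Finset.card_pair h₂₃] at this
    push_cast at this
    linarith
  have hsub₂ := networkH_submodular (W := W) (S := S) hP hP1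
    (J₁ := Y ∪ {a₂, a₃}) (E₁ := R ×ˢ {a₂, a₃})
    (J₂ := insert a₁ (Y ∪ F)) (E₂ := insert (a₂, a₃) (X ×ˢ {a₂, a₃}))
    (J₃ := Y ∪ F ∪ {a₁, a₂, a₃}) (E₃ := ∅)
    (J₄ := Y) (E₄ := insert (a₂, a₃) (insert a₁ (F ∪ X) ×ˢ {a₂, a₃}))
    (by
      intro ω ω' hω hω' h
      refine ⟨fun j hj => h.1 j (by simp [hj]), ?_⟩
      rintro ⟨i, j⟩ he
      simp only [Finset.mem_product, Finset.mem_insert, Finset.mem_singleton,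
        Finset.mem_union, Prod.mk.injEq] at he
      rcases he with ⟨rfl, rfl⟩ | he
      · exact hc.helper_eq hω hω' h₂₃ (h.1 _ (by simp))
      · refine h.2 (i, j) ?_
        simp only [hR, Finset.mem_product, Finset.mem_insert, Finset.mem_singleton,
          Finset.mem_union]
        tauto)
    (by
      intro ω ω' hω hω' h
      refine ⟨fun j hj => h.1 j (by simp [hj]), ?_⟩
      rintro ⟨i, j⟩ he
      simp only [Finset.mem_product, Finset.mem_insert, Finset.mem_singleton,
        Finset.mem_union, Prod.mk.injEq] at he
      rcases he with ⟨rfl, rfl⟩ | ⟨hi, hj⟩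
      · exact h.2 (_, _) (by simp)
      · by_cases hiX : i ∈ X
        · exact h.2 (i, j) (by simp [hiX, hj])
        · have hij : i ≠ j := by
            rcases hj with rfl | rfl
            · rcases hi with rfl | hi | hi
              exacts [h₁₂, hne hF₂ hi, hne hX₂ hi]
            · rcases hi with rfl | hi | hi
              exacts [h₁₃, hne hF₃ hi, hne hX₃ hi]
          refine hc.helper_eq hω hω' hij (h.1 i ?_)
          simp only [Finset.mem_insert, Finset.mem_union]
          tauto)
    (by
      intro ω ω' hω hω' h h'
      refine ⟨fun j hj => ?_, by simp⟩
      by_cases hj' : j ∈ Y ∪ {a₂, a₃}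
      · exact h.1 j hj'
      · refine h'.1 j ?_
        simp only [Finset.mem_insert, Finset.mem_singleton, Finset.mem_union] at hj hj' ⊢
        tauto)
  have hB₂ := hc.fileSize_le m (Y ∪ F ∪ {a₁, a₂, a₃}) (by
    rw [Finset.card_union_of_disjoint (by simp [hY₁, hY₂, hY₃, hF₁, hF₂, hF₃]),
      Finset.card_union_of_disjoint hYF.symm]
    simp [h₁₂, h₁₃, h₂₃]
    omega)
  -- Repairing `a₃`, then `a₂`, then `F`.
  have hlast : networkH P W S {a₄} (insert a₁ X ×ˢ F) ≤ α + (1 + X.card) * F.card * β := by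
    have := hc.networkH_le_card {a₄} (insert a₁ X ×ˢ F) (by
      rintro ⟨i, j⟩ he
      simp only [Finset.mem_product, Finset.mem_insert] at he
      rcases he with ⟨rfl | hi, hj⟩
      · exact (hne hF₁ hj).symm
      · exact fun h => Finset.disjoint_left.1 hXF hj (by simpa [← show i = j from h] using hi))
    rw [Finset.card_product, Finset.card_insert_of_notMem hX₁, Finset.card_singleton] at this
    push_cast at this
    linarith
  have hadd := networkH_le_add (W := W) (S := S) hP hP1
    (J₁ := Y) (E₁ := insert (a₂, a₃) (insert a₁ (F ∪ X) ×ˢ {a₂, a₃}))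
    (J₂ := {a₄}) (E₂ := insert a₁ X ×ˢ F)
    (J₃ := Y ∪ F ∪ {a₂, a₃, a₄}) (E₃ := ∅) (by
      intro ω ω' hω hω' h h'
      have e₄ : W a₄ ω = W a₄ ω' := h'.1 _ (by simp)
      have e₃ : W a₃ ω = W a₃ ω' := by
        refine hc.repair_eq hω hω' hVcard ha₃V fun i hi hia => ?_
        rcases (hVmem i).1 hi with rfl | rfl | rfl | rfl | hi | hi | hi
        · exact h.2 (_, _) (by simp)
        · exact h.2 (_, _) (by simp)
        · exact absurd rfl hia
        · exact hc.helper_eq hω hω' hia e₄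
        · exact h.2 (i, a₃) (by simp [hi])
        · exact hc.helper_eq hω hω' hia (h.1 i hi)
        · exact h.2 (i, a₃) (by simp [hi])
      have e₂ : W a₂ ω = W a₂ ω' := by
        refine hc.repair_eq hω hω' hVcard ha₂V fun i hi hia => ?_
        rcases (hVmem i).1 hi with rfl | rfl | rfl | rfl | hi | hi | hi
        · exact h.2 (_, _) (by simp)
        · exact absurd rfl hia
        · exact hc.helper_eq hω hω' hia e₃
        · exact hc.helper_eq hω hω' hia e₄
        · exact h.2 (i, a₂) (by simp [hi])
        · exact hc.helper_eq hω hω' hia (h.1 i hi)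
        · exact h.2 (i, a₂) (by simp [hi])
      refine ⟨fun j hj => ?_, by simp⟩
      simp only [Finset.mem_insert, Finset.mem_singleton, Finset.mem_union] at hj
      rcases hj with (hj | hj) | rfl | rfl | rfl
      · exact h.1 j hj
      · refine hc.repair_eq hω hω' hVcard ((hVmem j).2 (by simp [hj])) fun i hi hia => ?_
        rcases (hVmem i).1 hi with rfl | rfl | rfl | rfl | hi | hi | hi
        · exact h'.2 (_, _) (by simp [hj])
        · exact hc.helper_eq hω hω' hia e₂
        · exact hc.helper_eq hω hω' hia e₃
        · exact hc.helper_eq hω hω' hia e₄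
        · exact absurd (Finset.card_le_one.1 hF1 i hi j hj) hia
        · exact hc.helper_eq hω hω' hia (h.1 i hi)
        · exact h'.2 (i, j) (by simp [hi, hj])
      · exact e₂
      · exact e₃
      · exact e₄)
  have hB₃ := hc.fileSize_le m (Y ∪ F ∪ {a₂, a₃, a₄}) (by
    rw [Finset.card_union_of_disjoint (by simp [hY₂, hY₃, hY₄, hF₂, hF₃, hF₄]),
      Finset.card_union_of_disjoint hYF.symm]
    simp [h₂₃, h₂₄, h₃₄]
    omega)
  push_cast at hB₁
  rw [show (m : ℝ) + 1 + F.card - 1 = m + F.card by ring] at hB₁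
  linarith

lemma three_mul_fileSize_le_of_card (hc : IsRegenCode n k d B α β P M W S) {f y x m : ℕ}
    (hcard : 4 + f + y + x = d + 1) (hf : f ≤ 1) (hm : y + f + 3 + m = k) :
    3 * B ≤ (3 * y + f + 4) * α
      + (2 * (2 + f + x) + (1 + 2 * x) + (1 + x) * f) * β
      + ((m + 1 + f) * (m + f) / 2 + (d + 1 - k) * (m + 1 + f)) * β
      + 2 * ((m * (m - 1) / 2 + (d + 1 - k) * m) * β) := by
  have hdn := hc.hdn
  have hext : ∀ (A : Finset (Fin n)) (r : ℕ), A.card + r ≤ n →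
      ∃ D : Finset (Fin n), Disjoint A D ∧ D.card = r := by
    intro A r h
    obtain ⟨D, hD, hDr⟩ := Finset.exists_subset_card_eq (s := Aᶜ) (n := r) (by
      rw [Finset.card_compl, Fintype.card_fin]
      omega)
    exact ⟨D, Finset.disjoint_left.2 fun i hi hi' => Finset.mem_compl.1 (hD hi') hi, hDr⟩
  have h4 : ({⟨0, by omega⟩, ⟨1, by omega⟩, ⟨2, by omega⟩, ⟨3, by omega⟩} :
      Finset (Fin n)).card = 4 := by simp
  obtain ⟨F, hF, rfl⟩ := hext _ f (by rw [h4]; omega)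
  obtain ⟨Y, hY, rfl⟩ := hext _ y (by rw [Finset.card_union_of_disjoint hF, h4]; omega)
  obtain ⟨X, hX, rfl⟩ := hext _ x (by
    rw [Finset.card_union_of_disjoint hY, Finset.card_union_of_disjoint hF, h4]; omega)
  exact hc.three_mul_fileSize_le (by simp) (by simp) (by simp) (by simp) (by simp) (by simp)
    hF hY hX hcard hf m hm

end IsRegenCode

end RegeneratingCode

/-- for `2 ≤ p ≤ k - 2` and `(d-p)β ≤ α ≤ (d-p+1)β`,
`B ≤ B_p - β/6`. -/
theorem stmt_9 {Ω : Type*} [Fintype Ω] {n k d : ℕ} {B α β : ℝ} {P : Ω → ℝ}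
    {σM : Type*} {σW : Fin n → Type*} {σS : Fin n → Fin n → Type*}
    {M : Ω → σM} {W : ∀ j, Ω → σW j} {S : ∀ i j, Ω → σS i j}
    (hcode : IsRegenCode n k d B α β P M W S)
    (p : ℕ) (hp2 : 2 ≤ p) (hpk : p + 2 ≤ k)
    (hα1 : ((d - p : ℕ) : ℝ) * β ≤ α) (hα2 : α ≤ ((d - p + 1 : ℕ) : ℝ) * β) :
    B ≤ Bfun k d p α β - β / 6 := by
  have hkd := hcode.hkd
  have hdn := hcode.hdn
  obtain ⟨m, rfl⟩ := Nat.exists_eq_add_of_le hpk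
  obtain ⟨c, rfl⟩ := Nat.exists_eq_add_of_le hkd
  obtain ⟨q, rfl⟩ := Nat.exists_eq_add_of_le hp2
  have h₀ := hcode.three_mul_fileSize_le_of_card (f := 0) (y := q + 1) (x := m + c) (m := m)
    (by omega) (by omega) (by omega)
  have h₁ := hcode.three_mul_fileSize_le_of_card (f := 1) (y := q) (x := m + c) (m := m)
    (by omega) (by omega) (by omega)
  rw [Bfun, show 2 + q + 2 + m - (2 + q) = m + 2 by omega,
    show 2 + q + 2 + m + c + 1 - (2 + q + 2 + m) = c + 1 by omega, Nat.add_sub_assoc (by omega)]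
  push_cast at h₀ h₁ ⊢
  norm_num at h₀ h₁ ⊢
  nlinarith
end

section
/- Every exact-repair regenerating code with parameters (n,k,d) = (n,6,7), n ≥ 8, and secondary parameters (B,α,β) satisfies 7B ≤ 17α + 79β (equivalently, 7B ≤ 4B_2 + 3B_3 − 4β, where B_2 = 2α + 14β and B_3 = 3α + 9β). -/
open Finset

section Entropy

open Classical in
/-- The probability of the fibre of `X` through `ω`. -/
noncomputable def fibreMass {Ω S : Type*} [Fintype Ω] (P : Ω → ℝ) (X : Ω → S) (ω : Ω) : ℝ :=
  ∑ ω' ∈ Finset.univ.filter (fun ω' => X ω' = X ω), P ω'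

theorem entH_eq_neg_sum {Ω S : Type*} [Fintype Ω] (P : Ω → ℝ) (X : Ω → S) :
    entH P X = -∑ ω, P ω * Real.logb 2 (fibreMass P X ω) := by
  classical
  unfold entH
  rw [← Finset.sum_neg_distrib,
    ← Finset.sum_fiberwise_of_maps_to (s := Finset.univ) (t := Finset.univ.image X) (g := X)
      (fun ω _ => Finset.mem_image_of_mem X (Finset.mem_univ ω))]
  refine Finset.sum_congr rfl fun s _ => ?_
  rw [Finset.sum_mul, ← Finset.sum_neg_distrib]
  refine Finset.sum_congr (by ext; simp) fun ω hω => ?_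
  have hs : X ω = s := by simpa using hω
  subst hs
  unfold fibreMass
  congr!

theorem le_fibreMass {Ω S : Type*} [Fintype Ω] {P : Ω → ℝ} (hP : ∀ ω, 0 ≤ P ω) (X : Ω → S)
    (ω : Ω) : P ω ≤ fibreMass P X ω := by
  classical
  exact Finset.single_le_sum (f := P) (fun i _ => hP i) (by simp)

theorem fibreMass_congr {Ω S : Type*} [Fintype Ω] (P : Ω → ℝ) {X : Ω → S} {ω ω' : Ω}
    (h : X ω = X ω') : fibreMass P X ω = fibreMass P X ω' := by
  unfold fibreMass
  rw [h]

/-- Any sum of `P ω / fibreMass P X ω` over points lying in one fibre of `X` is at most `1`. -/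
theorem sum_div_fibreMass_le_one {Ω S : Type*} [Fintype Ω] {P : Ω → ℝ} (hP : ∀ ω, 0 ≤ P ω)
    (X : Ω → S) (T : Finset Ω) (hT : ∀ ω ∈ T, ∀ ω' ∈ T, X ω = X ω') :
    ∑ ω ∈ T, P ω / fibreMass P X ω ≤ 1 := by
  classical
  rcases T.eq_empty_or_nonempty with rfl | ⟨ω₀, h₀⟩
  · simp
  have h1 : ∑ ω ∈ T, P ω / fibreMass P X ω = (∑ ω ∈ T, P ω) / fibreMass P X ω₀ := by
    rw [Finset.sum_div]
    exact Finset.sum_congr rfl fun ω hω => by rw [fibreMass_congr P (hT ω hω ω₀ h₀)]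
  rw [h1]
  refine div_le_one_of_le₀ ?_ (Finset.sum_nonneg fun i _ => hP i)
  exact Finset.sum_le_sum_of_subset_of_nonneg
    (fun ω hω => by simpa using hT ω hω ω₀ h₀) fun i _ _ => hP i

theorem sum_mul_fibreMass_div_le_one {Ω SA SB SC SD : Type*} [Fintype Ω] {P : Ω → ℝ}
    (hP : ∀ ω, 0 ≤ P ω) (hsum : ∑ ω, P ω = 1)
    {A : Ω → SA} {B : Ω → SB} {C : Ω → SC} {D : Ω → SD}
    (hAC : ∀ ω ω', A ω = A ω' → C ω = C ω') (hBC : ∀ ω ω', B ω = B ω' → C ω = C ω')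
    (hD : ∀ ω ω', A ω = A ω' → B ω = B ω' → D ω = D ω') :
    ∑ ω, P ω * (fibreMass P A ω * fibreMass P B ω / (fibreMass P D ω * fibreMass P C ω)) ≤ 1 := by
  classical
  have hexp : ∀ ω, P ω * (fibreMass P A ω * fibreMass P B ω /
      (fibreMass P D ω * fibreMass P C ω)) =
      ∑ x, ∑ y, if A ω = A x ∧ B ω = B y then
        P x * (P y / fibreMass P C x) * (P ω / fibreMass P D ω) else 0 := by
    intro ω
    have hA : fibreMass P A ω = ∑ x, if A ω = A x then P x else 0 := by
      simp only [fibreMass, Finset.sum_filter, eq_comm]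
    have hB : fibreMass P B ω = ∑ y, if B ω = B y then P y else 0 := by
      simp only [fibreMass, Finset.sum_filter, eq_comm]
    have h1 : P ω * (fibreMass P A ω * fibreMass P B ω /
        (fibreMass P D ω * fibreMass P C ω)) =
        (fibreMass P A ω * fibreMass P B ω) * (P ω / fibreMass P D ω / fibreMass P C ω) := by
      rw [← div_div]; ring
    rw [h1, hA, hB, Finset.sum_mul_sum, Finset.sum_mul]
    refine Finset.sum_congr rfl fun x _ => ?_
    rw [Finset.sum_mul]
    refine Finset.sum_congr rfl fun y _ => ?_
    by_cases hx : A ω = A x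
    · by_cases hy : B ω = B y
      · simp only [hx, hy, and_self, if_true]
        rw [fibreMass_congr P (hAC ω x hx)]
        ring
      · simp [hy]
    · simp [hx]
  have hswap : ∀ x y, (∑ ω, if A ω = A x ∧ B ω = B y then
        P x * (P y / fibreMass P C x) * (P ω / fibreMass P D ω) else 0) ≤
      if C y = C x then P x * (P y / fibreMass P C y) else 0 := by
    intro x y
    rw [← Finset.sum_filter, ← Finset.mul_sum]
    have hle := sum_div_fibreMass_le_one hP D
      (Finset.univ.filter fun ω => A ω = A x ∧ B ω = B y) (by
        intro ω hω ω' hω'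
        simp only [Finset.mem_filter, Finset.mem_univ, true_and] at hω hω'
        exact hD _ _ (hω.1.trans hω'.1.symm) (hω.2.trans hω'.2.symm))
    by_cases hC : C y = C x
    · rw [if_pos hC, fibreMass_congr P hC]
      refine mul_le_of_le_one_right ?_ hle
      exact mul_nonneg (hP x) (div_nonneg (hP y) ((hP x).trans (le_fibreMass hP C x)))
    · rw [if_neg hC]
      refine le_of_eq ?_
      rw [Finset.filter_eq_empty_iff.mpr, Finset.sum_empty, mul_zero]
      rintro ω - ⟨h1, h2⟩
      exact hC ((hBC _ _ h2).symm.trans (hAC _ _ h1))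
  calc _ = ∑ ω, ∑ x, ∑ y, (if A ω = A x ∧ B ω = B y then
        P x * (P y / fibreMass P C x) * (P ω / fibreMass P D ω) else 0) :=
        Finset.sum_congr rfl fun ω _ => hexp ω
    _ = ∑ x, ∑ y, ∑ ω, (if A ω = A x ∧ B ω = B y then
        P x * (P y / fibreMass P C x) * (P ω / fibreMass P D ω) else 0) := by
        rw [Finset.sum_comm]
        exact Finset.sum_congr rfl fun x _ => Finset.sum_comm
    _ ≤ ∑ x, ∑ y, (if C y = C x then P x * (P y / fibreMass P C y) else 0) :=
        Finset.sum_le_sum fun x _ => Finset.sum_le_sum fun y _ => hswap x y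
    _ ≤ ∑ x, P x := by
        refine Finset.sum_le_sum fun x _ => ?_
        rw [← Finset.sum_filter, ← Finset.mul_sum]
        refine mul_le_of_le_one_right (hP x) (sum_div_fibreMass_le_one hP C _ ?_)
        intro ω hω ω' hω'
        simp only [Finset.mem_filter, Finset.mem_univ, true_and] at hω hω'
        exact hω.trans hω'.symm
    _ = 1 := hsum

/-- Submodularity of entropy: if `C` is a function of `A` and a function of `B`, and `D` is a
function of `(A, B)`, then `H(D) + H(C) ≤ H(A) + H(B)`. -/
theorem entH_add_le_add {Ω SA SB SC SD : Type*} [Fintype Ω] {P : Ω → ℝ}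
    (hP : ∀ ω, 0 ≤ P ω) (hsum : ∑ ω, P ω = 1)
    {A : Ω → SA} {B : Ω → SB} {C : Ω → SC} {D : Ω → SD}
    (hAC : ∀ ω ω', A ω = A ω' → C ω = C ω') (hBC : ∀ ω ω', B ω = B ω' → C ω = C ω')
    (hD : ∀ ω ω', A ω = A ω' → B ω = B ω' → D ω = D ω') :
    entH P D + entH P C ≤ entH P A + entH P B := by
  have hpt : ∀ ω, P ω * (Real.logb 2 (fibreMass P A ω) + Real.logb 2 (fibreMass P B ω)
      - Real.logb 2 (fibreMass P D ω) - Real.logb 2 (fibreMass P C ω)) ≤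
      (P ω * (fibreMass P A ω * fibreMass P B ω / (fibreMass P D ω * fibreMass P C ω)) - P ω)
        / Real.log 2 := by
    intro ω
    rcases (hP ω).eq_or_lt with h0 | h0
    · simp [← h0]
    have ha := h0.trans_le (le_fibreMass hP A ω)
    have hb := h0.trans_le (le_fibreMass hP B ω)
    have hc := h0.trans_le (le_fibreMass hP C ω)
    have hd := h0.trans_le (le_fibreMass hP D ω)
    have hlog := Real.log_le_sub_one_of_pos (div_pos (mul_pos ha hb) (mul_pos hd hc))
    rw [Real.log_div (by positivity) (by positivity), Real.log_mul ha.ne' hb.ne',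
      Real.log_mul hd.ne' hc.ne'] at hlog
    have h2 : 0 < Real.log 2 := Real.log_pos (by norm_num)
    rw [le_div_iff₀ h2]
    simp only [Real.logb]
    have := mul_le_mul_of_nonneg_left hlog h0.le
    calc _ = P ω * (Real.log (fibreMass P A ω) + Real.log (fibreMass P B ω)
          - (Real.log (fibreMass P D ω) + Real.log (fibreMass P C ω))) := by
            field_simp
            ring
      _ ≤ _ := by linarith
  have hall := Finset.sum_le_sum fun ω (_ : ω ∈ Finset.univ) => hpt ω
  rw [← Finset.sum_div, Finset.sum_sub_distrib, hsum] at hall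
  have hle := sum_mul_fibreMass_div_le_one hP hsum hAC hBC hD
  have hneg : (∑ ω, P ω * (fibreMass P A ω * fibreMass P B ω /
      (fibreMass P D ω * fibreMass P C ω)) - 1) / Real.log 2 ≤ 0 :=
    div_nonpos_of_nonpos_of_nonneg (by linarith) (Real.log_pos (by norm_num)).le
  simp only [mul_add, mul_sub, Finset.sum_add_distrib, Finset.sum_sub_distrib] at hall
  simp only [entH_eq_neg_sum]
  linarith

theorem entH_const {Ω S : Type*} [Fintype Ω] {P : Ω → ℝ} (hsum : ∑ ω, P ω = 1)
    {X : Ω → S} (hX : ∀ ω ω', X ω = X ω') : entH P X = 0 := by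
  have h (ω : Ω) : fibreMass P X ω = 1 := by
    simp [fibreMass, hX _ ω, hsum]
  simp [entH_eq_neg_sum, h]

/-- The entropy of a function of `A` is at most the entropy of `A`. -/
theorem entH_le_of_factors {Ω SA SD : Type*} [Fintype Ω] {P : Ω → ℝ}
    (hP : ∀ ω, 0 ≤ P ω) (hsum : ∑ ω, P ω = 1) {A : Ω → SA} {D : Ω → SD}
    (hD : ∀ ω ω', A ω = A ω' → D ω = D ω') : entH P D ≤ entH P A := by
  have h := entH_add_le_add hP hsum (A := A) (B := fun _ => ()) (C := fun _ => ()) (D := D)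
    (fun _ _ _ => rfl) (fun _ _ _ => rfl) (fun ω ω' h _ => hD ω ω' h)
  linarith

theorem entH_congr {Ω S T : Type*} [Fintype Ω] {P : Ω → ℝ}
    (hP : ∀ ω, 0 ≤ P ω) (hsum : ∑ ω, P ω = 1) {X : Ω → S} {Y : Ω → T}
    (h : ∀ ω ω', X ω = X ω' ↔ Y ω = Y ω') : entH P X = entH P Y :=
  le_antisymm (entH_le_of_factors hP hsum fun ω ω' => (h ω ω').2)
    (entH_le_of_factors hP hsum fun ω ω' => (h ω ω').1)

end Entropy

section Polymatroid

/-- The abstract entropy constraints satisfied by eight servers of a regenerating code with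
`k = 6` and `d = 7`: `Sum.inl j` stands for the data stored on server `j`, and `Sum.inr (i, j)`
for the helper data sent by server `i` to server `j`. -/
structure IsRepairPolymatroid (f : Finset (Fin 8 ⊕ Fin 8 × Fin 8) → ℝ) (B α β : ℝ) : Prop where
  empty : f ∅ = 0
  mono : Monotone f
  submod : ∀ X Y, f (X ∪ Y) + f (X ∩ Y) ≤ f X + f Y
  stored : ∀ j, f {.inl j} = α
  helper : ∀ i j, i ≠ j → f {.inr (i, j)} = β
  helper_of_stored : ∀ i j, i ≠ j → f {.inr (i, j), .inl i} = f {.inl i}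
  repair : ∀ j, f (insert (.inl j) (({j}ᶜ : Finset (Fin 8)).image fun i => .inr (i, j))) =
    f (({j}ᶜ : Finset (Fin 8)).image fun i => .inr (i, j))
  decode : ∀ J : Finset (Fin 8), 6 ≤ J.card → B ≤ f (J.image .inl)

namespace IsRepairPolymatroid

variable {f : Finset (Fin 8 ⊕ Fin 8 × Fin 8) → ℝ} {B α β : ℝ}

/-- All helper data sent to server `j`, together with the data stored there. -/
def repaired (j : Fin 8) : Finset (Fin 8 ⊕ Fin 8 × Fin 8) :=
  insert (.inl j) (({j}ᶜ : Finset (Fin 8)).image fun i => .inr (i, j))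

theorem union_le (h : IsRepairPolymatroid f B α β) (X Y : Finset (Fin 8 ⊕ Fin 8 × Fin 8)) :
    f (X ∪ Y) ≤ f X + f Y := by
  have h1 := h.submod X Y
  have h2 := h.mono (Finset.empty_subset (X ∩ Y))
  rw [h.empty] at h2
  linarith

/-- Elements determined by a subset of `X` may be added to `X` at no cost. -/
theorem union_le_of_determined (h : IsRepairPolymatroid f B α β)
    {X Y Z : Finset (Fin 8 ⊕ Fin 8 × Fin 8)} (hY : Y ⊆ X) (hZ : f (Z ∪ Y) = f Y) :
    f (X ∪ Z) ≤ f X := by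
  have h1 := h.submod X (Z ∪ Y)
  have h2 := h.mono (Finset.subset_inter hY Finset.subset_union_right : Y ⊆ X ∩ (Z ∪ Y))
  have h3 := h.mono (by grind : X ∪ Z ⊆ X ∪ (Z ∪ Y))
  linarith

theorem union_image_helper_le (h : IsRepairPolymatroid f B α β) (j : Fin 8)
    (X : Finset (Fin 8 ⊕ Fin 8 × Fin 8)) (K I : Finset (Fin 8)) (hK : j ∉ K) :
    (∀ i ∈ K, i ∉ I → .inl i ∈ X ∨ .inr (i, j) ∈ X) →
    f (X ∪ K.image fun i => .inr (i, j)) ≤ f X + (K ∩ I).card * β := by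
  induction K using Finset.induction_on with
  | empty => simp
  | insert i K hi ih =>
    intro hX
    have hij : i ≠ j := by grind
    have ih := ih (by grind) (fun i' hi' => hX i' (by grind))
    have hset : X ∪ (insert i K).image (fun i => Sum.inr (i, j)) =
        (X ∪ K.image fun i => Sum.inr (i, j)) ∪ {Sum.inr (i, j)} := by
      rw [Finset.image_insert]; grind
    rw [hset]
    by_cases hI : i ∈ I
    · have h1 := h.union_le (X ∪ K.image fun i => Sum.inr (i, j)) {Sum.inr (i, j)}
      rw [h.helper i j hij] at h1
      rw [Finset.insert_inter_of_mem hI, Finset.card_insert_of_notMem (by grind)]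
      push_cast
      linarith
    · rw [Finset.insert_inter_of_notMem hI]
      refine le_trans ?_ ih
      rcases hX i (by grind) hI with hw | hs
      · exact h.union_le_of_determined (Y := {.inl i}) (by grind)
          (by rw [← h.helper_of_stored i j hij]; rfl)
      · exact h.mono (by grind)

/-- Helper data sent by servers whose contents are already in `X` may be added at no cost. -/
theorem union_helpers_le (h : IsRepairPolymatroid f B α β)
    {X : Finset (Fin 8 ⊕ Fin 8 × Fin 8)} (Z : Finset (Fin 8 × Fin 8)) :
    (∀ p ∈ Z, p.1 ≠ p.2 ∧ .inl p.1 ∈ X) → f (X ∪ Z.image .inr) ≤ f X := by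
  induction Z using Finset.induction_on with
  | empty => simp
  | insert p Z hp ih =>
    intro hZ
    have ih := ih fun q hq => hZ q (Finset.mem_insert_of_mem hq)
    obtain ⟨hne, hX⟩ := hZ p (Finset.mem_insert_self p Z)
    have hset : X ∪ (insert p Z).image Sum.inr = (X ∪ Z.image Sum.inr) ∪ {Sum.inr p} := by
      rw [Finset.image_insert]; grind
    rw [hset]
    exact (h.union_le_of_determined (Y := {.inl p.1}) (by grind)
      (by rw [← h.helper_of_stored p.1 p.2 hne]; rfl)).trans ih

/-- Repairing server `j` costs at most `β` for each helper in `I`, provided the remaining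
helpers' contributions are available. -/
theorem union_repaired_le (h : IsRepairPolymatroid f B α β) (j : Fin 8) (I : Finset (Fin 8))
    (c : ℕ) (hc : I.card = c) {X : Finset (Fin 8 ⊕ Fin 8 × Fin 8)} (hj : j ∉ I)
    (hX : ∀ i, i ≠ j → i ∉ I → .inl i ∈ X ∨ .inr (i, j) ∈ X) :
    f (X ∪ repaired j) ≤ f X + c * β := by
  subst hc
  have h1 := h.union_image_helper_le j X {j}ᶜ I (by simp) (fun i hi => hX i (by simpa using hi))
  have hI : ({j}ᶜ : Finset (Fin 8)) ∩ I = I := by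
    rw [Finset.inter_eq_right]
    intro i hi
    simp only [Finset.mem_compl, Finset.mem_singleton]
    rintro rfl
    exact hj hi
  rw [hI] at h1
  have h2 := h.union_le_of_determined
    (X := X ∪ ({j}ᶜ : Finset (Fin 8)).image fun i => .inr (i, j)) (Z := {.inl j})
    Finset.subset_union_right (h.repair j)
  refine le_trans (h.mono ?_) (h2.trans h1)
  unfold repaired
  grind

theorem le_of_stored_mem (h : IsRepairPolymatroid f B α β) (J : Finset (Fin 8))
    (hJ : 6 ≤ J.card) {X : Finset (Fin 8 ⊕ Fin 8 × Fin 8)} (hX : J.image .inl ⊆ X) : B ≤ f X :=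
  (h.decode J hJ).trans (h.mono hX)

theorem stored_pair_le (h : IsRepairPolymatroid f B α β) (i j : Fin 8) :
    f {.inl i, .inl j} ≤ 2 * α := by
  have h1 := h.union_le {.inl i} {.inl j}
  rw [h.stored, h.stored] at h1
  rw [show ({.inl i, .inl j} : Finset (Fin 8 ⊕ Fin 8 × Fin 8)) = {.inl i} ∪ {.inl j} from rfl]
  linarith

theorem le_one_stored (h : IsRepairPolymatroid f B α β) : B ≤ α + 20 * β := by
  have h0 := h.stored 0
  have h1 := h.union_repaired_le 1 {2, 3, 4, 5, 6, 7} 6 rfl (X := {.inl 0}) (by decide) (by decide)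
  have h2 := h.union_repaired_le 2 {3, 4, 5, 6, 7} 5 rfl (X := {.inl 0} ∪ repaired 1)
    (by decide) (by decide)
  have h3 := h.union_repaired_le 3 {4, 5, 6, 7} 4 rfl (X := {.inl 0} ∪ repaired 1 ∪ repaired 2)
    (by decide) (by decide)
  have h4 := h.union_repaired_le 4 {5, 6, 7} 3 rfl
    (X := {.inl 0} ∪ repaired 1 ∪ repaired 2 ∪ repaired 3) (by decide) (by decide)
  have h5 := h.union_repaired_le 5 {6, 7} 2 rfl
    (X := {.inl 0} ∪ repaired 1 ∪ repaired 2 ∪ repaired 3 ∪ repaired 4) (by decide) (by decide)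
  have h6 := h.le_of_stored_mem {0, 1, 2, 3, 4, 5} (by decide)
    (X := {.inl 0} ∪ repaired 1 ∪ repaired 2 ∪ repaired 3 ∪ repaired 4 ∪ repaired 5) (by decide)
  push_cast at h1 h2 h3 h4 h5
  linarith

theorem three_mul_le (h : IsRepairPolymatroid f B α β) : 3 * B ≤ 8 * α + 29 * β := by
  set Q : Finset (Fin 8 ⊕ Fin 8 × Fin 8) := {.inl 4, .inl 5, .inl 6, .inl 7}
  set N : Finset (Fin 8 ⊕ Fin 8 × Fin 8) :=
    (({0, 1} : Finset (Fin 8)) ×ˢ {4, 5, 6, 7}).image .inr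
  have hX : f (Q ∪ repaired 4 ∪ repaired 5) ≤ 2 * α + 9 * β := by
    have h0 := h.stored_pair_le 6 7
    have h1 := h.union_repaired_le 4 {0, 1, 2, 3, 5} 5 rfl (X := {.inl 6, .inl 7})
      (by decide) (by decide)
    have h2 := h.union_repaired_le 5 {0, 1, 2, 3} 4 rfl (X := {.inl 6, .inl 7} ∪ repaired 4)
      (by decide) (by decide)
    have h3 := h.mono (by decide : Q ∪ repaired 4 ∪ repaired 5 ⊆
      {.inl 6, .inl 7} ∪ repaired 4 ∪ repaired 5)
    push_cast at h1 h2
    linarith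
  have hY : f (Q ∪ repaired 6 ∪ repaired 7) ≤ 2 * α + 9 * β := by
    have h0 := h.stored_pair_le 4 5
    have h1 := h.union_repaired_le 6 {0, 1, 2, 3, 7} 5 rfl (X := {.inl 4, .inl 5})
      (by decide) (by decide)
    have h2 := h.union_repaired_le 7 {0, 1, 2, 3} 4 rfl (X := {.inl 4, .inl 5} ∪ repaired 6)
      (by decide) (by decide)
    have h3 := h.mono (by decide : Q ∪ repaired 6 ∪ repaired 7 ⊆
      {.inl 4, .inl 5} ∪ repaired 6 ∪ repaired 7)
    push_cast at h1 h2
    linarith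
  have hQB : B ≤ f Q + 5 * β := by
    have h1 := h.union_repaired_le 3 {0, 1, 2} 3 rfl (X := Q) (by decide) (by decide)
    have h2 := h.union_repaired_le 2 {0, 1} 2 rfl (X := Q ∪ repaired 3) (by decide) (by decide)
    have h3 := h.le_of_stored_mem {2, 3, 4, 5, 6, 7} (by decide)
      (X := Q ∪ repaired 3 ∪ repaired 2) (by decide)
    push_cast at h1 h2
    linarith
  have hNB : B ≤ f ({.inl 2, .inl 3} ∪ N) + 6 * β := by
    have h1 := h.union_repaired_le 4 {5, 6, 7} 3 rfl (X := {.inl 2, .inl 3} ∪ N)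
      (by decide) (by decide)
    have h2 := h.union_repaired_le 5 {6, 7} 2 rfl (X := {.inl 2, .inl 3} ∪ N ∪ repaired 4)
      (by decide) (by decide)
    have h3 := h.union_repaired_le 6 {7} 1 rfl
      (X := {.inl 2, .inl 3} ∪ N ∪ repaired 4 ∪ repaired 5) (by decide) (by decide)
    have h4 := h.union_repaired_le 7 ∅ 0 rfl
      (X := {.inl 2, .inl 3} ∪ N ∪ repaired 4 ∪ repaired 5 ∪ repaired 6) (by decide) (by decide)
    have h5 := h.le_of_stored_mem {2, 3, 4, 5, 6, 7} (by decide)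
      (X := {.inl 2, .inl 3} ∪ N ∪ repaired 4 ∪ repaired 5 ∪ repaired 6 ∪ repaired 7) (by decide)
    push_cast at h1 h2 h3 h4
    linarith
  have hQ' := h.submod (Q ∪ repaired 4 ∪ repaired 5) (Q ∪ repaired 6 ∪ repaired 7)
  have hQ'' := h.mono (Finset.subset_inter
    (by decide : Q ⊆ Q ∪ repaired 4 ∪ repaired 5) (by decide : Q ⊆ Q ∪ repaired 6 ∪ repaired 7))
  set C := Q ∪ repaired 4 ∪ repaired 5 ∪ (Q ∪ repaired 6 ∪ repaired 7)
  have hZ : f ({.inl 0, .inl 1} ∪ N) ≤ 2 * α := by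
    have h0 := h.stored_pair_le 0 1
    exact (h.union_helpers_le _ (by decide)).trans h0
  have hCZ := h.submod C ({.inl 0, .inl 1} ∪ N)
  have hN' := h.mono (Finset.subset_inter
    (by decide : N ⊆ C) (Finset.subset_union_right : N ⊆ {.inl 0, .inl 1} ∪ N))
  have hB := h.le_of_stored_mem {0, 1, 4, 5, 6, 7} (by decide)
    (X := C ∪ ({.inl 0, .inl 1} ∪ N)) (by decide)
  have hN'' := h.union_le {.inl 2, .inl 3} N
  have h23 := h.stored_pair_le 2 3
  linarith

end IsRepairPolymatroid

end Polymatroid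

section Code

variable {Ω : Type*} {n : ℕ} {B α β : ℝ} {P : Ω → ℝ}
  {σM : Type*} {σW : Fin n → Type*} {σS : Fin n → Fin n → Type*}
  {M : Ω → σM} {W : ∀ j, Ω → σW j} {S : ∀ i j, Ω → σS i j}

/-- Two outcomes are related when they agree on the piece of data labelled by `a`, the eight
servers being singled out by `e`. -/
def sameData (W : ∀ j, Ω → σW j) (S : ∀ i j, Ω → σS i j) (e : Fin 8 → Fin n) :
    Fin 8 ⊕ Fin 8 × Fin 8 → Setoid Ω
  | .inl j => Setoid.ker (W (e j))
  | .inr (i, j) => Setoid.ker (S (e i) (e j))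

theorem sameData_inl (e : Fin 8 → Fin n) (j : Fin 8) (ω ω' : Ω) :
    sameData W S e (.inl j) ω ω' ↔ W (e j) ω = W (e j) ω' :=
  Iff.rfl

theorem sameData_inr (e : Fin 8 → Fin n) (i j : Fin 8) (ω ω' : Ω) :
    sameData W S e (.inr (i, j)) ω ω' ↔ S (e i) (e j) ω = S (e i) (e j) ω' :=
  Iff.rfl

/-- The joint random variable of all pieces of data labelled by elements of `X`. -/
def jointData (W : ∀ j, Ω → σW j) (S : ∀ i j, Ω → σS i j) (e : Fin 8 → Fin n)
    (X : Finset (Fin 8 ⊕ Fin 8 × Fin 8)) :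
    Ω → ∀ a : X, Quotient (sameData W S e a.1) :=
  fun ω a => Quotient.mk (sameData W S e a.1) ω

theorem jointData_eq_iff (e : Fin 8 → Fin n) (X : Finset (Fin 8 ⊕ Fin 8 × Fin 8)) (ω ω' : Ω) :
    jointData W S e X ω = jointData W S e X ω' ↔ ∀ a ∈ X, sameData W S e a ω ω' := by
  simp only [jointData, funext_iff, Quotient.eq, Subtype.forall]

theorem IsRegenCode.isRepairPolymatroid [Fintype Ω] (hcode : IsRegenCode n 6 7 B α β P M W S)
    (e : Fin 8 ↪ Fin n) :
    IsRepairPolymatroid (fun X => entH P (jointData W S e X)) B α β where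
  empty := entH_const hcode.prob_sum fun ω ω' => by simp [jointData_eq_iff]
  mono X Y hXY := entH_le_of_factors hcode.prob_nonneg hcode.prob_sum fun ω ω' => by
    simp only [jointData_eq_iff]
    exact fun h a ha => h a (hXY ha)
  submod X Y := by
    refine entH_add_le_add hcode.prob_nonneg hcode.prob_sum ?_ ?_ ?_ <;> intro ω ω' <;>
      simp only [jointData_eq_iff, Finset.mem_inter, Finset.mem_union]
    · exact fun h a ha => h a ha.1
    · exact fun h a ha => h a ha.2
    · exact fun h h' a ha => ha.elim (h a) (h' a)
  stored j := by
    rw [← hcode.hWα (e j)]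
    refine entH_congr hcode.prob_nonneg hcode.prob_sum fun ω ω' => ?_
    simp only [jointData_eq_iff]
    simp [sameData_inl]
  helper i j hij := by
    rw [← hcode.hSβ (e i) (e j) (e.injective.ne hij)]
    refine entH_congr hcode.prob_nonneg hcode.prob_sum fun ω ω' => ?_
    simp only [jointData_eq_iff]
    simp [sameData_inr]
  helper_of_stored i j hij := by
    have h := sub_eq_zero.1 (hcode.hSW (e i) (e j) (e.injective.ne hij))
    refine Eq.trans ?_ (h.trans ?_) <;>
      refine entH_congr hcode.prob_nonneg hcode.prob_sum fun ω ω' => ?_ <;>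
      simp only [jointData_eq_iff] <;>
      simp [sameData_inl, sameData_inr]
  repair j := by
    have h := sub_eq_zero.1 (hcode.hWS (e j) (({j}ᶜ : Finset (Fin 8)).map e)
      (by simp [Finset.card_compl]) (by simp))
    refine Eq.trans ?_ (h.trans ?_) <;>
      refine entH_congr hcode.prob_nonneg hcode.prob_sum fun ω ω' => ?_ <;>
      simp only [jointData_eq_iff] <;>
      simp [sameData_inl, sameData_inr, jointSto, funext_iff]
  decode J hJ := by
    have h := sub_eq_zero.1 (hcode.hMW (J.map e) (by simpa using hJ))
    rw [← hcode.hMB]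
    refine (entH_le_of_factors hcode.prob_nonneg hcode.prob_sum ?_).trans
      (h.trans (entH_congr hcode.prob_nonneg hcode.prob_sum ?_)).le
    · exact fun ω ω' h => congrArg Prod.fst h
    · intro ω ω'
      simp only [jointData_eq_iff]
      simp [sameData_inl, jointW, funext_iff]

end Code

/-- every `(n,6,7)` exact-repair code with `n ≥ 8` satisfies
`7B ≤ 17α + 79β`. -/
theorem stmt_13 {Ω : Type*} [Fintype Ω] {n : ℕ} {B α β : ℝ} {P : Ω → ℝ}
    {σM : Type*} {σW : Fin n → Type*} {σS : Fin n → Fin n → Type*}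
    {M : Ω → σM} {W : ∀ j, Ω → σW j} {S : ∀ i j, Ω → σS i j}
    (hn : 8 ≤ n)
    (hcode : IsRegenCode n 6 7 B α β P M W S) :
    7 * B ≤ 17 * α + 79 * β := by
  have h := hcode.isRepairPolymatroid (Fin.castLEEmb hn)
  linarith [h.three_mul_le, h.le_one_stored, hcode.hβ]
end
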